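/- Let m and n be positive integers such that 3 divides m and either m ≡ 4 (mod 16) and n ≡ 4 (mod 16), or m ≡ 12 (mod 16) and n ≡ 12 (mod 16). Then every (m,n,3,2,1)-OOSPC has at most (13mn−16)/64 codewords. -/

import Mathlib

open Finset

/-- An (m,n,k,lamA,lamC)-OOSPC: a family of k-subsets of Z_m x Z_n with
auto-correlation at most lamA and cross-correlation at most lamC. -/
def OOSPC (m n k lamA lamC : ℕ) (F : Finset (Finset (ZMod m × ZMod n))) : Prop :=
  (∀ X ∈ F, X.card = k) ∧
  (∀ X ∈ F, ∀ g : ZMod m × ZMod n, g ≠ 0 →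
    (X ∩ X.image (fun x => g + x)).card ≤ lamA) ∧
  (∀ X ∈ F, ∀ Y ∈ F, X ≠ Y → ∀ g : ZMod m × ZMod n,
    (X ∩ Y.image (fun x => g + x)).card ≤ lamC)

/-- The leave of a family: nonzero elements of Z_m x Z_n not occurring as a
difference of two elements of a member of the family. -/
def leave (m n : ℕ) (F : Finset (Finset (ZMod m × ZMod n))) : Set (ZMod m × ZMod n) :=
  {g | g ≠ 0 ∧ ∀ X ∈ F, ∀ x ∈ X, ∀ y ∈ X, x - y ≠ g}

/-- (s,t)-regularity: the leave together with 0 equals S × T, where S and T are the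
unique subgroups of order s of Z_m and of order t of Z_n (for s ∣ m, t ∣ n these are
exactly the elements killed by s, resp. t). -/
def Regular (m n s t : ℕ) (F : Finset (Finset (ZMod m × ZMod n))) : Prop :=
  insert (0 : ZMod m × ZMod n) (leave m n F) =
    {p : ZMod m × ZMod n | s • p.1 = 0 ∧ t • p.2 = 0}

/-- ξ: the number of subgroups of order 3 in Z_m × Z_n. -/
def xi (m n : ℕ) : ℕ := if 3 ∣ m ∧ 3 ∣ n then 4 else if 3 ∣ m * n then 1 else 0

/-- ω = 0 if lamA = 2, and ω = ξ if lamA = 3. -/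
def omega (lamA m n : ℕ) : ℕ := if lamA = 2 then 0 else xi m n

section Weights

variable {G : Type*} [AddCommGroup G] [DecidableEq G]

/-- The set of differences of distinct elements of `X`. -/
def differences (X : Finset G) : Finset G := X.offDiag.image fun p => p.1 - p.2

/-- The weight of an element of a group of exponent dividing `4 * q`, with `q` odd. -/
def weight (q : ℕ) (g : G) : ℕ :=
  if g = 0 then 0 else if q • g = 0 then 3 else if 2 • g = 0 then 8
  else if (2 * q) • g = 0 then 4 else 2

/-- The total weight of the pair `{d, -d}`. -/
def pairWeight (q : ℕ) (d : G) : ℕ :=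
  if q • d = 0 then 6 else if (2 * q) • d = 0 then 8 else 4

lemma sub_mem_differences {X : Finset G} {x y : G} (hx : x ∈ X) (hy : y ∈ X) (h : x ≠ y) :
    x - y ∈ differences X :=
  mem_image.2 ⟨(x, y), mem_offDiag.2 ⟨hx, hy, h⟩, rfl⟩

lemma pair_subset_differences {X : Finset G} {x y : G} (hx : x ∈ X) (hy : y ∈ X) (h : x ≠ y) :
    {x - y, -(x - y)} ⊆ differences X := by
  intro d hd
  rw [mem_insert, mem_singleton] at hd
  rcases hd with rfl | rfl
  · exact sub_mem_differences hx hy h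
  · rw [neg_sub]
    exact sub_mem_differences hy hx h.symm

lemma weight_neg (q : ℕ) (g : G) : weight q (-g) = weight q g := by
  simp [weight]

lemma sum_weight_pair {q : ℕ} (hq : Odd q) {d : G} (hd : d ≠ 0) :
    ∑ g ∈ {d, -d}, weight q g = pairWeight q d := by
  by_cases h : d = -d
  · have h2 : 2 • d = 0 := by rw [two_nsmul]; nth_rewrite 1 [h]; simp
    have hqd : q • d = d := by
      obtain ⟨r, rfl⟩ := hq
      have e : (2 * r + 1) • d = r • (2 • d) + d := by module
      rw [e, h2, smul_zero, zero_add]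
    have h2q : (2 * q) • d = 0 := by rw [mul_nsmul', hqd, h2]
    rw [← h]
    simp [weight, pairWeight, hd, h2, hqd, h2q]
  · have h2 : 2 • d ≠ 0 := by
      rw [two_nsmul]
      exact fun h' => h (eq_neg_of_add_eq_zero_left h')
    rw [sum_pair h, weight_neg]
    unfold weight pairWeight
    rw [if_neg hd, if_neg h2]
    split_ifs <;> rfl

lemma four_le_pairWeight (q : ℕ) (d : G) : 4 ≤ pairWeight q d := by
  unfold pairWeight
  split_ifs <;> norm_num

lemma disjoint_pair {a b : G} (h : a ≠ b) (h' : a ≠ -b) :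
    Disjoint ({a, -a} : Finset G) {b, -b} := by
  rw [disjoint_left]
  simp only [mem_insert, mem_singleton]
  rintro x (rfl | rfl) (h1 | h1)
  · exact h h1
  · exact h' h1
  · exact h' (by rw [← h1, neg_neg])
  · exact h (neg_inj.1 h1)

/-- In an arithmetic progression, the differences weigh at least 12, and strictly more if
some difference has order 3. -/
lemma weight_progression {q : ℕ} (hq : Odd q) (hG : ∀ g : G, (4 * q) • g = 0) {t : G}
    (ht : 3 • t = 0) (hqt : q • t = 0) {a : G} (h2 : 2 • a ≠ 0) (h3 : 3 • a ≠ 0) :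
    12 + (if t ∈ ({a, -a} ∪ {2 • a, -(2 • a)} : Finset G) then 1 else 0) ≤
      ∑ g ∈ {a, -a} ∪ {2 • a, -(2 • a)}, weight q g := by
  have h1 : a ≠ 0 := by rintro rfl; simp at h2
  rw [sum_union, sum_weight_pair hq h1, sum_weight_pair hq h2]
  · have key : t ∈ ({a, -a} ∪ {2 • a, -(2 • a)} : Finset G) → q • (2 • a) = 0 ∧ q • a ≠ 0 := by
      have aux : q • a = 0 → 6 • a ≠ 0 := by
        intro hqa h6
        obtain ⟨r, rfl⟩ := hq
        apply h3
        have e : 3 • ((2 * r + 1) • a) = r • (6 • a) + 3 • a := by module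
        simpa [hqa, h6] using e.symm
      have h6 : 3 • (2 • a) = 6 • a := by module
      simp only [mem_union, mem_insert, mem_singleton]
      rintro ((rfl | rfl) | (rfl | rfl))
      · exact absurd ht h3
      · exact absurd (by simpa using ht) h3
      · exact ⟨hqt, fun h => aux h (by rw [← h6, ht])⟩
      · exact ⟨by simpa using hqt, fun h => aux h (by rw [← h6]; simpa using ht)⟩
    have e1 : (2 * q) • a = q • (2 • a) := by module
    have e2 : (2 * q) • (2 • a) = 0 := by rw [← hG a]; module
    by_cases hqa : q • a = 0
    · have hqa2 : q • (2 • a) = 0 := by rw [smul_comm, hqa, smul_zero]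
      rw [if_neg fun h => (key h).2 hqa]
      simp [pairWeight, hqa, hqa2]
    · by_cases hqa2 : q • (2 • a) = 0
      · have : pairWeight q a = 8 := by simp [pairWeight, hqa, e1, hqa2]
        have : pairWeight q (2 • a) = 6 := by simp [pairWeight, hqa2]
        split_ifs <;> omega
      · rw [if_neg fun h => hqa2 (key h).1]
        simp [pairWeight, hqa, e1, hqa2, e2]
  · apply disjoint_pair
    · intro h
      apply h1
      simpa [two_nsmul] using h
    · intro h
      apply h3
      have : 3 • a = a + 2 • a := by module
      rw [this]
      nth_rewrite 1 [h]
      simp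

lemma weight_differences_of_progression {q : ℕ} (hq : Odd q) (hG : ∀ g : G, (4 * q) • g = 0)
    {t : G} (ht : 3 • t = 0) (hqt : q • t = 0) {x a : G} (h1 : a ≠ 0) (h2 : 2 • a ≠ 0)
    (h3 : 3 • a ≠ 0) :
    12 + (if t ∈ differences {x, x + a, x + 2 • a} then 1 else 0) ≤
      ∑ g ∈ differences {x, x + a, x + 2 • a}, weight q g := by
  have e : differences {x, x + a, x + 2 • a} = {a, -a} ∪ {2 • a, -(2 • a)} := by
    apply Subset.antisymm
    · intro d
      simp only [differences, mem_image, mem_offDiag, mem_insert, mem_singleton, mem_union]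
      rintro ⟨⟨u, v⟩, ⟨hu, hv, huv⟩, rfl⟩
      dsimp only at hu hv huv ⊢
      rcases hu with rfl | rfl | rfl <;> rcases hv with rfl | rfl | rfl <;>
        simp [two_nsmul] at huv ⊢
    · apply union_subset
      · have := pair_subset_differences (X := {x, x + a, x + 2 • a}) (x := x + a) (y := x)
          (by simp) (by simp) (by simpa using h1)
        simpa using this
      · have := pair_subset_differences (X := {x, x + a, x + 2 • a}) (x := x + 2 • a) (y := x)
          (by simp) (by simp) (by simpa using h2)
        simpa using this
  rw [e]
  exact weight_progression hq hG ht hqt h2 h3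

lemma weight_differences_of_sub_eq {q : ℕ} (hq : Odd q) (hG : ∀ g : G, (4 * q) • g = 0)
    {t : G} (ht : 3 • t = 0) (hqt : q • t = 0) {X : Finset G}
    (hX : ∀ g : G, g ≠ 0 → #(X ∩ X.image (fun x => g + x)) ≤ 2)
    {x y z : G} (hXe : X = {x, y, z}) (hxy : x ≠ y) (hxz : x ≠ z) (hyz : y ≠ z)
    (h : y - x = z - y) :
    12 + (if t ∈ differences X then 1 else 0) ≤ ∑ g ∈ differences X, weight q g := by
  obtain ⟨a, rfl⟩ : ∃ a, y = x + a := ⟨y - x, by abel⟩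
  obtain rfl : z = x + 2 • a := by
    rw [eq_sub_iff_add_eq] at h
    rw [← h]
    module
  subst hXe
  have h1 : a ≠ 0 := by simpa using hxy
  refine weight_differences_of_progression hq hG ht hqt h1 (by simpa using hxz) fun h3 => ?_
  have e : ({x, x + a, x + 2 • a} : Finset G) ⊆
      ({x, x + a, x + 2 • a} : Finset G).image (fun x => a + x) := by
    simp only [image_insert, image_singleton]
    have e1 : a + (x + 2 • a) = x := by
      have : a + (x + 2 • a) = x + 3 • a := by module
      rw [this, h3, add_zero]
    have e2 : a + (x + a) = x + 2 • a := by module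
    rw [e1, e2, add_comm a x]
    intro g
    simp only [mem_insert, mem_singleton]
    tauto
  have := hX a h1
  rw [inter_eq_left.2 e, card_eq_three.2 ⟨_, _, _, hxy, hxz, hyz, rfl⟩] at this
  omega

lemma weight_differences {q : ℕ} (hq : Odd q) (hG : ∀ g : G, (4 * q) • g = 0)
    {t : G} (ht : 3 • t = 0) (hqt : q • t = 0) {X : Finset G} (hc : #X = 3)
    (hX : ∀ g : G, g ≠ 0 → #(X ∩ X.image (fun x => g + x)) ≤ 2) :
    12 + (if t ∈ differences X then 1 else 0) ≤ ∑ g ∈ differences X, weight q g := by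
  obtain ⟨x, y, z, hxy, hxz, hyz, hXe⟩ := card_eq_three.1 hc
  by_cases c1 : y - x = z - y
  · exact weight_differences_of_sub_eq hq hG ht hqt hX hXe hxy hxz hyz c1
  by_cases c2 : z - y = x - z
  · exact weight_differences_of_sub_eq hq hG ht hqt hX
      (by rw [hXe]; ext; simp; tauto) hyz hxy.symm hxz.symm c2
  by_cases c3 : x - z = y - x
  · exact weight_differences_of_sub_eq hq hG ht hqt hX
      (by rw [hXe]; ext; simp; tauto) hxz.symm hyz.symm hxy c3
  have n1 : y - x ≠ -(z - y) := fun h => hxz (by simpa [eq_comm] using h)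
  have n2 : z - y ≠ -(x - z) := fun h => hxy (by simpa using h.symm)
  have n3 : x - z ≠ -(y - x) := fun h => hyz (by simpa using h.symm)
  have d1 := disjoint_pair c1 n1
  have d2 := disjoint_pair c2 n2
  have d3 := disjoint_pair c3 n3
  have hdiff : differences X = {y - x, -(y - x)} ∪ {z - y, -(z - y)} ∪ {x - z, -(x - z)} := by
    apply Subset.antisymm
    · intro d
      simp only [hXe, differences, mem_image, mem_offDiag, mem_insert, mem_singleton, mem_union]
      rintro ⟨⟨u, v⟩, ⟨hu, hv, huv⟩, rfl⟩
      dsimp only at hu hv huv ⊢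
      rcases hu with rfl | rfl | rfl <;> rcases hv with rfl | rfl | rfl <;> simp at huv ⊢
    · refine union_subset (union_subset ?_ ?_) ?_ <;> apply pair_subset_differences <;>
        simp [hXe, hxy.symm, hxz, hyz.symm]
  rw [hdiff, sum_union (disjoint_union_left.2 ⟨d3.symm, d2⟩), sum_union d1,
    sum_weight_pair hq (sub_ne_zero.2 hxy.symm), sum_weight_pair hq (sub_ne_zero.2 hyz.symm),
    sum_weight_pair hq (sub_ne_zero.2 hxz)]
  have l1 := four_le_pairWeight q (y - x)
  have l2 := four_le_pairWeight q (z - y)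
  have l3 := four_le_pairWeight q (x - z)
  have six : ∀ d : G, t = d ∨ t = -d → pairWeight q d = 6 := by
    rintro d (rfl | rfl)
    · simp [pairWeight, hqt]
    · simp [pairWeight, show q • d = 0 by simpa using hqt]
  split_ifs with h
  · simp only [mem_union, mem_insert, mem_singleton] at h
    rcases h with (h | h) | h <;> have := six _ h <;> omega
  · omega

lemma disjoint_differences {X Y : Finset G}
    (h : ∀ g : G, #(X ∩ Y.image (fun x => g + x)) ≤ 1) :
    Disjoint (differences X) (differences Y) := by
  rw [disjoint_left]
  simp only [differences, mem_image, mem_offDiag]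
  rintro _ ⟨⟨x, x'⟩, ⟨hx, hx', hne⟩, rfl⟩ ⟨⟨y, y'⟩, ⟨hy, hy', -⟩, e⟩
  dsimp only at *
  refine hne (card_le_one.1 (h (x - y)) x ?_ x' ?_)
  · exact mem_inter.2 ⟨hx, mem_image.2 ⟨y, hy, by abel⟩⟩
  · refine mem_inter.2 ⟨hx', mem_image.2 ⟨y', hy', ?_⟩⟩
    rw [sub_eq_sub_iff_add_eq_add] at e
    rw [sub_add_eq_add_sub, sub_eq_iff_eq_add, add_comm x', e, add_comm]

lemma sum_weight [Fintype G] {q : ℕ} (hq : Odd q) :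
    ∑ g : G, weight q g + #{g : G | q • g = 0} + 7 =
      2 * Fintype.card G + 2 * #{g : G | (2 * q) • g = 0} + 4 * #{g : G | 2 • g = 0} := by
  have hz : 7 = ∑ g : G, if g = 0 then 7 else 0 := by simp
  have hu : Fintype.card G = ∑ g : G, 1 := by simp
  rw [card_filter, card_filter, card_filter, hu, mul_sum, mul_sum, mul_sum,
    ← sum_add_distrib, ← sum_add_distrib]
  nth_rewrite 1 [hz]
  rw [← sum_add_distrib, ← sum_add_distrib]
  refine sum_congr rfl fun g _ => ?_
  by_cases h0 : g = 0
  · simp [h0, weight]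
  by_cases hqg : q • g = 0
  · have h2q : (2 * q) • g = 0 := by rw [mul_nsmul', hqg, smul_zero]
    have h2 : 2 • g ≠ 0 := by
      intro h2
      obtain ⟨r, rfl⟩ := hq
      apply h0
      have e : (2 * r + 1) • g = r • (2 • g) + g := by module
      simpa [hqg, h2] using e.symm
    simp [weight, h0, hqg, h2q, h2]
  by_cases h2 : 2 • g = 0
  · have h2q : (2 * q) • g = 0 := by rw [mul_nsmul, h2, smul_zero]
    simp [weight, h0, hqg, h2q, h2]
  by_cases h2q : (2 * q) • g = 0 <;> simp [weight, h0, hqg, h2q, h2]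

lemma twelve_mul_card_lt_sum_weight [Fintype G] {q : ℕ} (hq : Odd q)
    (hG : ∀ g : G, (4 * q) • g = 0) {t : G} (ht0 : t ≠ 0) (ht : 3 • t = 0) (hqt : q • t = 0)
    {F : Finset (Finset G)} (hc : ∀ X ∈ F, #X = 3)
    (hauto : ∀ X ∈ F, ∀ g : G, g ≠ 0 → #(X ∩ X.image (fun x => g + x)) ≤ 2)
    (hcross : ∀ X ∈ F, ∀ Y ∈ F, X ≠ Y → ∀ g : G, #(X ∩ Y.image (fun x => g + x)) ≤ 1) :
    12 * #F < ∑ g : G, weight q g := by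
  have hdisj : (F : Set (Finset G)).PairwiseDisjoint differences :=
    fun X hX Y hY hne => disjoint_differences (hcross X hX Y hY hne)
  have h1 : 12 * #F + (∑ g ∈ F.biUnion differences, if t = g then 1 else 0) ≤
      ∑ g ∈ F.biUnion differences, weight q g := by
    rw [sum_biUnion hdisj, sum_biUnion hdisj, mul_comm, ← smul_eq_mul, ← sum_const,
      ← sum_add_distrib]
    refine sum_le_sum fun X hX => ?_
    rw [sum_ite_eq]
    exact weight_differences hq hG ht hqt (hc X hX) (hauto X hX)
  have h2 : (∑ g ∈ (F.biUnion differences)ᶜ, if t = g then 1 else 0) ≤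
      ∑ g ∈ (F.biUnion differences)ᶜ, weight q g := by
    refine sum_le_sum fun g _ => ?_
    split_ifs with h
    · subst h
      simp [weight, ht0, hqt]
    · exact Nat.zero_le _
  have h3 := sum_add_sum_compl (F.biUnion differences) fun g => if t = g then 1 else 0
  have h4 := sum_add_sum_compl (F.biUnion differences) (weight q)
  have h5 : (∑ g : G, if t = g then 1 else 0) = 1 := by simp
  omega

end Weights

lemma card_nsmul_eq_zero_zmod_prod (m n d : ℕ) [NeZero m] [NeZero n] :
    #{g : ZMod m × ZMod n | d • g = 0} = m.gcd d * n.gcd d := by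
  have h : ∀ k [NeZero k], #{x : ZMod k | d • x = 0} = k.gcd d := by
    intro k _
    have := IsAddCyclic.card_nsmulAddMonoidHom_ker (G := ZMod k) d
    rw [Nat.card_zmod] at this
    rw [← this, ← Fintype.card_subtype, ← Nat.card_eq_fintype_card]
    rfl
  rw [← h m, ← h n, ← card_product]
  congr 1
  ext ⟨x, y⟩
  simp only [mem_filter_univ, mem_product, Prod.smul_mk, Prod.mk_eq_zero]

theorem stmt10 (m n : ℕ) (hm : 0 < m) (hn : 0 < n) (h3m : 3 ∣ m)
    (hcase : (m % 16 = 4 ∧ n % 16 = 4) ∨ (m % 16 = 12 ∧ n % 16 = 12))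
    (F : Finset (Finset (ZMod m × ZMod n))) (hF : OOSPC m n 3 2 1 F) :
    F.card ≤ (13 * m * n - 16) / 64 := by
  obtain ⟨hc, hauto, hcross⟩ := hF
  have : NeZero m := ⟨hm.ne'⟩
  have : NeZero n := ⟨hn.ne'⟩
  obtain ⟨a, rfl⟩ : 4 ∣ m := by omega
  obtain ⟨b, rfl⟩ : 4 ∣ n := by omega
  obtain ⟨c, rfl⟩ : 3 ∣ a := by omega
  have hab : (3 * c * b) % 4 = 1 := by
    rw [Nat.mul_mod]
    rcases hcase with ⟨h1, h2⟩ | ⟨h1, h2⟩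
    · rw [show 3 * c % 4 = 1 by omega, show b % 4 = 1 by omega]
    · rw [show 3 * c % 4 = 3 by omega, show b % 4 = 3 by omega]
  have ha : Odd (3 * c) := Nat.odd_iff.2 (by omega)
  have hb : Odd b := Nat.odd_iff.2 (by omega)
  have hq := ha.mul hb
  have hG : ∀ g : ZMod (4 * (3 * c)) × ZMod (4 * b), (4 * (3 * c * b)) • g = 0 := by
    rintro ⟨x, y⟩
    have hx : (4 * (3 * c)) • x = 0 := by simp [-Nat.cast_mul]
    have hy : (4 * b) • y = 0 := by simp [-Nat.cast_mul]
    refine Prod.ext ?_ ?_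
    · change (4 * (3 * c * b)) • x = 0
      rw [show 4 * (3 * c * b) = b * (4 * (3 * c)) by ring, mul_nsmul', hx, smul_zero]
    · change (4 * (3 * c * b)) • y = 0
      rw [show 4 * (3 * c * b) = 3 * c * (4 * b) by ring, mul_nsmul', hy, smul_zero]
  have ht : 3 • (((4 * c : ℕ) : ZMod (4 * (3 * c))), (0 : ZMod (4 * b))) = 0 := by
    refine Prod.ext ?_ (by simp)
    change 3 • ((4 * c : ℕ) : ZMod (4 * (3 * c))) = 0
    rw [nsmul_eq_mul, ← Nat.cast_mul, show 3 * (4 * c) = 4 * (3 * c) by ring,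
      ZMod.natCast_self]
  have ht0 : (((4 * c : ℕ) : ZMod (4 * (3 * c))), (0 : ZMod (4 * b))) ≠ 0 := by
    intro h
    have h' : ((4 * c : ℕ) : ZMod (4 * (3 * c))) = 0 := congrArg Prod.fst h
    rw [ZMod.natCast_eq_zero_iff] at h'
    have := Nat.le_of_dvd (by omega) h'
    omega
  have hlt := twelve_mul_card_lt_sum_weight hq hG ht0 ht
    (by rw [show 3 * c * b = c * b * 3 by ring, mul_nsmul', ht, smul_zero]) hc hauto hcross
  have hs := sum_weight (G := ZMod (4 * (3 * c)) × ZMod (4 * b)) hq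
  have gcd_odd : ∀ k l : ℕ, Odd l → k ∣ l → Nat.gcd (4 * k) l = k := fun k l hl hk => by
    have : Nat.Coprime 4 l := Nat.Coprime.pow_left 2 hl.coprime_two_left
    rw [this.gcd_mul_left_cancel, Nat.gcd_eq_left hk]
  have gcd_even : ∀ k l : ℕ, Odd l → k ∣ l → Nat.gcd (4 * k) (2 * l) = 2 * k := by
    intro k l hl hk
    have : Nat.Coprime 2 l := hl.coprime_two_left
    rw [show 4 * k = 2 * (2 * k) by ring, Nat.gcd_mul_left, this.gcd_mul_left_cancel,
      Nat.gcd_eq_left hk]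
  have gcd_two : ∀ k : ℕ, Nat.gcd (4 * k) 2 = 2 := fun k =>
    Nat.gcd_eq_right ⟨2 * k, by ring⟩
  rw [card_nsmul_eq_zero_zmod_prod, card_nsmul_eq_zero_zmod_prod, card_nsmul_eq_zero_zmod_prod,
    gcd_two, gcd_two, gcd_odd _ _ hq (Dvd.intro _ rfl), gcd_odd _ _ hq (Dvd.intro_left _ rfl),
    gcd_even _ _ hq (Dvd.intro _ rfl), gcd_even _ _ hq (Dvd.intro_left _ rfl),
    Fintype.card_prod, ZMod.card, ZMod.card] at hs
  rw [show 13 * (4 * (3 * c)) * (4 * b) = 208 * (3 * c * b) by ring]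
  rw [show 4 * (3 * c) * (4 * b) = 16 * (3 * c * b) by ring,
    show 2 * (3 * c) * (2 * b) = 4 * (3 * c * b) by ring] at hs
  generalize 3 * c * b = q at *
  omega
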